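/- There exists a universal constant C > 0 such that for all integers q ≥ 1 and n ≥ 2, every matrix Q ∈ {−1,1}^{q×n}, and every function T : {−1,1}^q → {0,1}: | E_{f ∼ D_yes}[ T(f(Q_{1*}),…,f(Q_{q*})) ] − E_{f ∼ D_no}[ T(f(Q_{1*}),…,f(Q_{q*})) ] | ≤ C · q^{5/4} · (ln n)^{1/2} / n^{1/4}, where Q_{i*} ∈ {−1,1}^n denotes the i-th row of Q. -/

import Mathlib

open Finset

/-- A point of the hypercube `{-1,1}^n` encoded as a Boolean vector:
`false ↦ -1`, `true ↦ 1`. -/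
noncomputable def pm (b : Bool) : ℝ := if b then 1 else -1

/-- The LTF `sign(σ₁x₁ + ⋯ + σₙxₙ)` drawn from `D_yes`, where the Boolean vector `s`
encodes the weights: `σ i = 1` if `s i = false` and `σ i = 3` if `s i = true`.
`sign(t) = 1` iff `t ≥ 0`; the output `1` is encoded by `true` and `-1` by `false`. -/
noncomputable def fYes {n : ℕ} (s : Fin n → Bool) : (Fin n → Bool) → Bool :=
  fun x => if 0 ≤ ∑ i : Fin n, (if s i then (3 : ℝ) else 1) * pm (x i) then true else false

/-- The LTF `sign(ν₁x₁ + ⋯ + νₙxₙ)` drawn from `D_no`: `ν i = -1` if `b i = false`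
and `ν i = 7/3` if `b i = true`. -/
noncomputable def fNo {n : ℕ} (b : Fin n → Bool) : (Fin n → Bool) → Bool :=
  fun x => if 0 ≤ ∑ i : Fin n, (if b i then (7 : ℝ)/3 else -1) * pm (x i) then true else false

/-- The probability weight of the weight vector encoded by `b` under `D_no`:
each coordinate is independently `-1` with probability `1/10` and `7/3` with
probability `9/10`. -/
noncomputable def wNo {n : ℕ} (b : Fin n → Bool) : ℝ :=
  ∏ i : Fin n, (if b i then (9 : ℝ)/10 else 1/10)

open MeasureTheory ProbabilityTheory Matrix
open scoped ENNReal NNReal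

lemma cm1 (a : ℝ) (f : ℝ → ℝ≥0∞) (hf : Measurable f) :
    ∫⁻ t, f (t + a) ∂(gaussianReal 0 1) =
      ∫⁻ t, f t * ENNReal.ofReal (Real.exp (a * t - a ^ 2 / 2)) ∂(gaussianReal 0 1) := by
  rw [gaussianReal_of_var_ne_zero _ one_ne_zero]
  rw [lintegral_withDensity_eq_lintegral_mul _ (measurable_gaussianPDF 0 1) (by fun_prop),
    lintegral_withDensity_eq_lintegral_mul _ (measurable_gaussianPDF 0 1) (by fun_prop)]
  rw [← lintegral_add_right_eq_self (μ := volume) _ (-a)]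
  refine lintegral_congr fun t => ?_
  simp only [Pi.mul_apply, neg_add_cancel_right]
  rw [mul_comm (f t), ← mul_assoc]
  congr 1
  rw [gaussianPDF, gaussianPDF, ← ENNReal.ofReal_mul (gaussianPDFReal_nonneg _ _ _)]
  congr 1
  simp only [gaussianPDFReal]
  rw [mul_assoc (√_)⁻¹, ← Real.exp_add]
  congr 2
  simp
  ring

lemma taylor_pt (s y : ℝ) (hs : |s| ≤ 1) :
    |Real.exp (s * y - s ^ 2 / 2) - (1 + s * y + s ^ 2 * (y ^ 2 - 1) / 2)| ≤
      |s| ^ 3 * (7 * Real.exp (2 * (|y| + 1))) := by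
  set z := s * y - s ^ 2 / 2 with hz
  have h1 : |Real.exp z - (1 + z + z ^ 2 / 2)| ≤ |z| ^ 3 * Real.exp |z| := by
    have := Complex.norm_exp_sub_sum_le_norm_mul_exp (z : ℂ) 3
    simp only [Finset.sum_range_succ, Finset.sum_range_zero] at this
    have h2 : Complex.exp (z : ℂ) - (0 + (z : ℂ) ^ 0 / (Nat.factorial 0 : ℂ) + (z : ℂ) ^ 1 / (Nat.factorial 1 : ℂ)
        + (z : ℂ) ^ 2 / (Nat.factorial 2 : ℂ)) = ((Real.exp z - (1 + z + z ^ 2 / 2) : ℝ) : ℂ) := by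
      push_cast
      norm_num [Nat.factorial]
    rw [h2, Complex.norm_real, Complex.norm_real] at this
    simpa using this
  have hzb : |z| ≤ |s| * (|y| + 1) := by
    have : |z| ≤ |s * y| + |s ^ 2 / 2| := abs_sub _ _
    rw [abs_mul, abs_div, abs_pow] at this
    norm_num at this
    nlinarith [abs_nonneg s, sq_abs s]
  have hzb' : |z| ≤ |y| + 1 := hzb.trans (by nlinarith [abs_nonneg y])
  set e := Real.exp (|y| + 1) with he
  have he2 : Real.exp (2 * (|y| + 1)) = e * e := by rw [he, ← Real.exp_add]; ring_nf
  have h3 : (|y| + 1) ^ 3 ≤ 6 * e := by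
    have := Real.pow_div_factorial_le_exp (|y| + 1) (by positivity) 3
    norm_num [Nat.factorial] at this
    linarith
  have h4 : |y| + 1 ≤ e := by have := Real.add_one_le_exp (|y| + 1); linarith
  have h5 : 1 ≤ e := by linarith [abs_nonneg y]
  have h6 : |z| ^ 3 * Real.exp |z| ≤ |s| ^ 3 * (6 * (e * e)) := by
    calc |z| ^ 3 * Real.exp |z| ≤ (|s| * (|y| + 1)) ^ 3 * e := by
          gcongr
          exact Real.exp_le_exp.2 hzb'
      _ = |s| ^ 3 * ((|y| + 1) ^ 3 * e) := by ring
      _ ≤ |s| ^ 3 * ((6 * e) * e) := by gcongr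
      _ = _ := by ring
  have h7 : |(1 + z + z ^ 2 / 2) - (1 + s * y + s ^ 2 * (y ^ 2 - 1) / 2)| ≤ |s| ^ 3 * (e * e) := by
    have : (1 + z + z ^ 2 / 2) - (1 + s * y + s ^ 2 * (y ^ 2 - 1) / 2) = s ^ 3 * (s / 8 - y / 2) := by
      rw [hz]; ring
    rw [this, abs_mul, abs_pow]
    gcongr
    calc |s / 8 - y / 2| ≤ |s / 8| + |y / 2| := abs_sub _ _
      _ ≤ |y| + 1 := by
        rw [abs_div, abs_div]; norm_num; linarith [abs_nonneg y]
      _ ≤ e := h4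
      _ ≤ e * e := by nlinarith
  rw [he2]
  calc _ ≤ |Real.exp z - (1 + z + z ^ 2 / 2)| + |(1 + z + z ^ 2 / 2) - (1 + s * y + s ^ 2 * (y ^ 2 - 1) / 2)| :=
        abs_sub_le _ _ _
    _ ≤ _ := by linarith

lemma int_exp_abs (c : ℝ) : Integrable (fun y => Real.exp (c * |y|)) (gaussianReal 0 1) :=
  integrable_exp_mul_abs (X := fun y => y) (integrable_exp_mul_gaussianReal c)
    (integrable_exp_mul_gaussianReal (-c))

lemma int_pow (k : ℕ) : Integrable (fun y => y ^ k) (gaussianReal 0 1) := by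
  have h := (memLp_id_gaussianReal (μ := 0) (v := 1) (k : ℝ≥0)).integrable_norm_pow' 
  simp only [id] at h
  refine (integrable_norm_iff (by fun_prop)).1 ?_
  simpa using h

lemma int_sq_gauss : ∫ y, y ^ 2 ∂(gaussianReal 0 1) = 1 := by
  have h := variance_fun_id_gaussianReal (μ := 0) (v := 1)
  rw [variance_eq_integral (by fun_prop)] at h
  simpa using h

lemma int_taylor (s : ℝ) :
   Integrable (fun y => Real.exp (s * y - s ^ 2 / 2) - (1 + s * y + s ^ 2 * (y ^ 2 - 1) / 2)) (gaussianReal 0 1) := by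
  have h1 := (integrable_exp_mul_gaussianReal (μ := 0) (v := 1) s).mul_const (Real.exp (-(s ^ 2 / 2)))
  have h2 := int_pow 1
  have h3 := int_pow 2
  simp only [pow_one] at h2
  refine Integrable.sub ?_ ?_
  · convert h1 using 2 with y
    rw [← Real.exp_add]; ring_nf
  · refine ((integrable_const 1).add (h2.const_mul s)).add ?_
    exact ((h3.sub (integrable_const 1)).const_mul _).div_const _

lemma taylor1 : ∃ C : ℝ, 0 < C ∧ ∀ s : ℝ,
    ∫ y, |Real.exp (s * y - s ^ 2 / 2) - (1 + s * y + s ^ 2 * (y ^ 2 - 1) / 2)| ∂(gaussianReal 0 1)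
      ≤ C * |s| ^ 3 := by
  set K := ∫ y, 7 * Real.exp (2 * (|y| + 1)) ∂(gaussianReal 0 1) with hK
  have hKi : Integrable (fun y => 7 * Real.exp (2 * (|y| + 1))) (gaussianReal 0 1) := by
    have := ((int_exp_abs 2).mul_const (Real.exp 2)).const_mul 7
    convert this using 3 with y
    rw [← Real.exp_add]; ring_nf
  have hK0 : 0 ≤ K := integral_nonneg fun y => by positivity
  refine ⟨K + 5, by linarith, fun s => ?_⟩
  rcases le_or_gt |s| 1 with hs | hs
  · calc _ ≤ ∫ y, |s| ^ 3 * (7 * Real.exp (2 * (|y| + 1))) ∂(gaussianReal 0 1) := by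
          refine integral_mono (int_taylor s).abs (hKi.const_mul _) fun y => taylor_pt s y hs
      _ = |s| ^ 3 * K := by rw [integral_const_mul]
      _ ≤ _ := by
        have : 0 ≤ |s| ^ 3 := by positivity
        nlinarith
  · have h1 : Integrable (fun y => Real.exp (s * y - s ^ 2 / 2)) (gaussianReal 0 1) := by
      have h1 := (integrable_exp_mul_gaussianReal (μ := 0) (v := 1) s).mul_const (Real.exp (-(s ^ 2 / 2)))
      convert h1 using 2 with y
      rw [← Real.exp_add]; ring_nf
    have h1v : ∫ y, Real.exp (s * y - s ^ 2 / 2) ∂(gaussianReal 0 1) = 1 := by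
      have h := congrFun (mgf_fun_id_gaussianReal (μ := 0) (v := 1)) s
      simp only [mgf] at h
      have : (fun y => Real.exp (s * y - s ^ 2 / 2)) = fun y => Real.exp (s * y) * Real.exp (-(s ^ 2 / 2)) := by
        ext y; rw [← Real.exp_add]; ring_nf
      rw [this, integral_mul_const, h, ← Real.exp_add]
      simp
    have h2 : Integrable (fun y : ℝ => 1 + |s| * (1 + y ^ 2) + s ^ 2 * (y ^ 2 + 1) / 2) (gaussianReal 0 1) := by
      have h3 := int_pow 2
      refine ((integrable_const 1).add (((integrable_const 1).add h3).const_mul |s|)).add ?_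
      exact ((h3.add (integrable_const 1)).const_mul _).div_const _
    have h2v : ∫ y, (1 + |s| * (1 + y ^ 2) + s ^ 2 * (y ^ 2 + 1) / 2) ∂(gaussianReal 0 1) = 1 + 2 * |s| + s ^ 2 := by
      have : (fun y : ℝ => 1 + |s| * (1 + y ^ 2) + s ^ 2 * (y ^ 2 + 1) / 2) =
        fun y => (1 + |s| + s ^ 2 / 2) + (|s| + s ^ 2 / 2) * y ^ 2 := by ext y; ring
      rw [this, integral_add (integrable_const _) ((int_pow 2).const_mul _), integral_const_mul, int_sq_gauss]
      simp
      ring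
    calc _ ≤ ∫ y, (Real.exp (s * y - s ^ 2 / 2) + (1 + |s| * (1 + y ^ 2) + s ^ 2 * (y ^ 2 + 1) / 2)) ∂(gaussianReal 0 1) := by
          refine integral_mono (int_taylor s).abs (h1.add h2) fun y => ?_
          have hy : |y| ≤ 1 + y ^ 2 := by nlinarith [sq_abs y, sq_nonneg (|y| - 1)]
          have h3 : |s * y| ≤ |s| * (1 + y ^ 2) := by rw [abs_mul]; gcongr
          have h4 := abs_le.1 h3
          refine abs_le.2 ⟨?_, ?_⟩
          · nlinarith [Real.exp_pos (s * y - s ^ 2 / 2), sq_nonneg s]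
          · nlinarith [Real.exp_pos (s * y - s ^ 2 / 2), sq_nonneg s, mul_nonneg (sq_nonneg s) (sq_nonneg y)]
      _ = 2 + 2 * |s| + s ^ 2 := by
          rw [integral_add h1 h2, h1v, h2v]; ring
      _ ≤ _ := by
        rw [← sq_abs s]
        have h3 : |s| ^ 2 ≤ |s| ^ 3 := pow_le_pow_right₀ hs.le (by norm_num)
        have h4 : |s| ≤ |s| ^ 2 := by nlinarith
        nlinarith


/-- `μ` is the centred Gaussian law with covariance `M` (in Cameron-Martin form). -/
structure IsG {ι : Type} [Fintype ι] (μ : Measure (ι → ℝ)) (M : Matrix ι ι ℝ) : Prop where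
  prob : IsProbabilityMeasure μ
  nonneg : ∀ u : ι → ℝ, 0 ≤ u ⬝ᵥ (M *ᵥ u)
  law : ∀ u : ι → ℝ, μ.map (fun x => u ⬝ᵥ x) = gaussianReal 0 (Real.toNNReal (u ⬝ᵥ (M *ᵥ u)))
  cm : ∀ (u : ι → ℝ) (f : (ι → ℝ) → ℝ≥0∞), Measurable f →
    ∫⁻ x, f (x + M *ᵥ u) ∂μ =
      ∫⁻ x, f x * ENNReal.ofReal (Real.exp (u ⬝ᵥ x - (u ⬝ᵥ (M *ᵥ u)) / 2)) ∂μ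

lemma meas_dot {ι : Type} [Fintype ι] (u : ι → ℝ) : Measurable (fun x : ι → ℝ => u ⬝ᵥ x) := by
  unfold dotProduct
  fun_prop

lemma isG_zero {ι : Type} [Fintype ι] : IsG (Measure.dirac (0 : ι → ℝ)) 0 where
  prob := inferInstance
  nonneg u := by simp
  law u := by
    rw [Measure.map_dirac' (meas_dot u)]
    simp [gaussianReal_zero_var]
  cm u f hf := by
    have h1 : Measurable fun x : ι → ℝ => u ⬝ᵥ x := meas_dot u
    rw [lintegral_dirac' _ (by fun_prop), lintegral_dirac' _ (by fun_prop)]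
    simp

/-- add an independent standard Gaussian along `v`. -/
noncomputable def addG {ι : Type} [Fintype ι] (μ : Measure (ι → ℝ)) (v : ι → ℝ) : Measure (ι → ℝ) :=
  ((gaussianReal 0 1).prod μ).map (fun p => p.2 + p.1 • v)

lemma quad_add {ι : Type} [Fintype ι] (M : Matrix ι ι ℝ) (v u : ι → ℝ) :
    u ⬝ᵥ ((M + vecMulVec v v) *ᵥ u) = u ⬝ᵥ (M *ᵥ u) + (u ⬝ᵥ v) ^ 2 := by
  rw [add_mulVec, dotProduct_add, vecMulVec_mulVec]
  simp [dotProduct_smul, dotProduct_comm v u, sq]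

lemma IsG.add {ι : Type} [Fintype ι] {μ : Measure (ι → ℝ)} {M : Matrix ι ι ℝ} (h : IsG μ M)
    (v : ι → ℝ) : IsG (addG μ v) (M + vecMulVec v v) := by
  have := h.prob
  have hm : Measurable (fun p : ℝ × (ι → ℝ) => p.2 + p.1 • v) := by fun_prop
  refine ⟨?_, ?_, ?_, ?_⟩
  · exact Measure.isProbabilityMeasure_map hm.aemeasurable
  · intro u
    rw [quad_add]
    exact add_nonneg (h.nonneg u) (sq_nonneg _)
  · intro u
    have hu := meas_dot u
    rw [addG, Measure.map_map hu hm, quad_add, Real.toNNReal_add (h.nonneg u) (sq_nonneg _)]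
    have h1 : (fun x : ι → ℝ => u ⬝ᵥ x) ∘ (fun p : ℝ × (ι → ℝ) => p.2 + p.1 • v) =
        (fun p : ℝ × ℝ => p.1 + p.2) ∘ (Prod.map (fun t => (u ⬝ᵥ v) * t) (fun x => u ⬝ᵥ x)) := by
      ext p
      simp [dotProduct_add, dotProduct_smul]
      ring
    rw [h1, ← Measure.map_map (by fun_prop) (by fun_prop),
      ← Measure.map_prod_map _ _ (by fun_prop) hu, h.law u, gaussianReal_map_const_mul]
    have h2 := gaussianReal_conv_gaussianReal (m₁ := 0) (m₂ := 0) (v₁ := Real.toNNReal ((u ⬝ᵥ v) ^ 2))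
      (v₂ := Real.toNNReal (u ⬝ᵥ (M *ᵥ u)))
    rw [Measure.conv] at h2
    rw [add_comm (Real.toNNReal _), mul_zero]
    rw [add_zero] at h2
    rw [← h2]
    congr 3
    ext
    simp [Real.coe_toNNReal _ (sq_nonneg (u ⬝ᵥ v))]
  · intro u f hf
    have hu := meas_dot u
    rw [addG, lintegral_map (by fun_prop) hm, lintegral_map (by fun_prop) hm]
    rw [lintegral_prod _ (by fun_prop), lintegral_prod _ (by fun_prop)]
    set a := u ⬝ᵥ v
    have h1 : ∀ t : ℝ, ∫⁻ x, f (x + t • v + (M + vecMulVec v v) *ᵥ u) ∂μ =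
        ∫⁻ x, f (x + (t + a) • v) * ENNReal.ofReal (Real.exp (u ⬝ᵥ x - (u ⬝ᵥ (M *ᵥ u)) / 2)) ∂μ := by
      intro t
      rw [← h.cm u (fun x => f (x + (t + a) • v)) (by fun_prop)]
      refine lintegral_congr fun x => ?_
      congr 1
      rw [add_mulVec, vecMulVec_mulVec]
      simp only [a, add_smul, dotProduct_comm v u]
      simp
      abel
    simp only [h1]
    rw [cm1 a (fun t => ∫⁻ x, f (x + t • v) * ENNReal.ofReal (Real.exp (u ⬝ᵥ x - (u ⬝ᵥ (M *ᵥ u)) / 2)) ∂μ)]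
    · refine lintegral_congr fun t => ?_
      rw [← lintegral_mul_const _ (by fun_prop)]
      refine lintegral_congr fun x => ?_
      rw [mul_assoc, ← ENNReal.ofReal_mul (Real.exp_pos _).le, ← Real.exp_add, quad_add,
        dotProduct_add, dotProduct_smul]
      congr 3
      simp only [smul_eq_mul, a]
      ring
    · exact Measurable.lintegral_prod_right' (f := fun p : ℝ × (ι → ℝ) => f (p.2 + p.1 • v) *
        ENNReal.ofReal (Real.exp (u ⬝ᵥ p.2 - (u ⬝ᵥ (M *ᵥ u)) / 2))) (by fun_prop)

lemma IsG.shift {ι : Type} [Fintype ι] {μ : Measure (ι → ℝ)} {M : Matrix ι ι ℝ} (h : IsG μ M)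
    (u : ι → ℝ) (f : (ι → ℝ) → ℝ) (hf : Measurable f) (h0 : ∀ x, 0 ≤ f x) :
    ∫ x, f (x + M *ᵥ u) ∂μ = ∫ x, f x * Real.exp (u ⬝ᵥ x - (u ⬝ᵥ (M *ᵥ u)) / 2) ∂μ := by
  have hu := meas_dot u
  rw [integral_eq_lintegral_of_nonneg_ae (ae_of_all _ fun x => h0 _)
      (Measurable.aestronglyMeasurable (by fun_prop)),
    integral_eq_lintegral_of_nonneg_ae (ae_of_all _ fun x => mul_nonneg (h0 _) (Real.exp_pos _).le)
      (Measurable.aestronglyMeasurable (by fun_prop))]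
  congr 1
  rw [h.cm u (fun x => ENNReal.ofReal (f x)) (by fun_prop)]
  refine lintegral_congr fun x => ?_
  rw [ENNReal.ofReal_mul (h0 _)]

/-- laws of linear functionals as rescalings of a standard Gaussian -/
lemma IsG.law' {ι : Type} [Fintype ι] {μ : Measure (ι → ℝ)} {M : Matrix ι ι ℝ} (h : IsG μ M)
    (u : ι → ℝ) : μ.map (fun x => u ⬝ᵥ x) =
      (gaussianReal 0 1).map (fun y => √(u ⬝ᵥ (M *ᵥ u)) * y) := by
  rw [h.law, gaussianReal_map_const_mul]
  congr 1
  · simp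
  · ext
    simp [Real.sq_sqrt (h.nonneg u), h.nonneg u]

lemma IsG.integral_lin {ι : Type} [Fintype ι] {μ : Measure (ι → ℝ)} {M : Matrix ι ι ℝ} (h : IsG μ M)
    (u : ι → ℝ) (g : ℝ → ℝ) (hg : Measurable g) :
    ∫ x, g (u ⬝ᵥ x) ∂μ = ∫ y, g (√(u ⬝ᵥ (M *ᵥ u)) * y) ∂(gaussianReal 0 1) := by
  have hu := meas_dot u
  rw [← integral_map (φ := fun x => u ⬝ᵥ x) (f := g) hu.aemeasurable hg.aestronglyMeasurable,
    h.law' u, integral_map (by fun_prop) hg.aestronglyMeasurable]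

lemma IsG.integrable_lin {ι : Type} [Fintype ι] {μ : Measure (ι → ℝ)} {M : Matrix ι ι ℝ} (h : IsG μ M)
    (u : ι → ℝ) (g : ℝ → ℝ) (hg : Measurable g)
    (hi : Integrable (fun y => g (√(u ⬝ᵥ (M *ᵥ u)) * y)) (gaussianReal 0 1)) :
    Integrable (fun x => g (u ⬝ᵥ x)) μ := by
  have hu := meas_dot u
  have : Integrable g (μ.map (fun x => u ⬝ᵥ x)) := by
    rw [h.law' u, integrable_map_measure hg.aestronglyMeasurable (by fun_prop)]
    exact hi
  exact (integrable_map_measure hg.aestronglyMeasurable hu.aemeasurable).1 this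

lemma step_taylor : ∃ C : ℝ, 0 < C ∧ ∀ (ι : Type) [Fintype ι] (μ : Measure (ι → ℝ))
    (M : Matrix ι ι ℝ), IsG μ M → ∀ (u : ι → ℝ) (f : (ι → ℝ) → ℝ), Measurable f →
    (∀ x, 0 ≤ f x) → (∀ x, f x ≤ 1) → ∃ a b c : ℝ, ∀ t : ℝ,
    |∫ x, f (x + t • (M *ᵥ u)) ∂μ - (a + b * t + c * t ^ 2)| ≤
      C * (√(u ⬝ᵥ (M *ᵥ u))) ^ 3 * |t| ^ 3 := by
  obtain ⟨C, hC, hT⟩ := taylor1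
  refine ⟨C, hC, fun ι _ μ M h u f hf h0 h1 => ?_⟩
  have := h.prob
  have hu := meas_dot u
  set τ := u ⬝ᵥ (M *ᵥ u) with hτ
  have hτ0 : 0 ≤ τ := h.nonneg u
  have hfi : Integrable f μ := by
    refine Integrable.of_bound hf.aestronglyMeasurable 1 (ae_of_all _ fun x => ?_)
    rw [Real.norm_of_nonneg (h0 x)]; exact h1 x
  have i1 : Integrable (fun x => u ⬝ᵥ x) μ := by
    refine h.integrable_lin u (fun y => y) measurable_id ?_
    have := int_pow 1
    simp only [pow_one] at this
    exact this.const_mul _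
  have i2 : Integrable (fun x => (u ⬝ᵥ x) ^ 2) μ := by
    refine h.integrable_lin u (fun y => y ^ 2) (by fun_prop) ?_
    simp only [mul_pow]
    exact (int_pow 2).const_mul _
  have hmulf : ∀ g : (ι → ℝ) → ℝ, Integrable g μ → Integrable (fun x => f x * g x) μ := by
    intro g hg
    refine hg.bdd_mul hf.aestronglyMeasurable (c := 1) (ae_of_all _ fun x => ?_)
    rw [Real.norm_of_nonneg (h0 x)]; exact h1 x
  refine ⟨∫ x, f x ∂μ, ∫ x, f x * (u ⬝ᵥ x) ∂μ, ∫ x, f x * (((u ⬝ᵥ x) ^ 2 - τ) / 2) ∂μ, fun t => ?_⟩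
  set R : ℝ → ℝ := fun y => Real.exp (t * y - t ^ 2 * τ / 2) - (1 + t * y + t ^ 2 * (y ^ 2 - τ) / 2) with hR
  have hRm : Measurable R := by fun_prop
  have hRs : ∀ y, R (√τ * y) = Real.exp ((t * √τ) * y - (t * √τ) ^ 2 / 2)
      - (1 + (t * √τ) * y + (t * √τ) ^ 2 * (y ^ 2 - 1) / 2) := by
    intro y
    simp only [hR, mul_pow, Real.sq_sqrt hτ0]
    ring_nf
  have iR : Integrable (fun x => R (u ⬝ᵥ x)) μ := by
    refine h.integrable_lin u R hRm ?_
    rw [← hτ]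
    simp only [hRs]
    exact int_taylor _
  have hsh := h.shift (t • u) f hf h0
  have e1 : M *ᵥ (t • u) = t • (M *ᵥ u) := mulVec_smul _ _ _
  have e2 : ∀ x, f x * Real.exp ((t • u) ⬝ᵥ x - ((t • u) ⬝ᵥ (M *ᵥ (t • u))) / 2) =
      f x * R (u ⬝ᵥ x) + (f x + t * (f x * (u ⬝ᵥ x)) + t ^ 2 * (f x * (((u ⬝ᵥ x) ^ 2 - τ) / 2))) := by
    intro x
    rw [e1]
    simp only [smul_dotProduct, dotProduct_smul, smul_eq_mul, ← hτ, hR]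
    ring_nf
  simp only [e2] at hsh
  have j1 := hmulf _ i1
  have j2 := hmulf _ ((i2.sub (integrable_const τ)).div_const 2)
  simp only [Pi.sub_apply] at j2
  have k1 : Integrable (fun x => f x + t * (f x * (u ⬝ᵥ x))) μ := hfi.add (j1.const_mul t)
  have k2 : Integrable (fun x => f x + t * (f x * (u ⬝ᵥ x)) +
      t ^ 2 * (f x * (((u ⬝ᵥ x) ^ 2 - τ) / 2))) μ := k1.add (j2.const_mul _)
  rw [integral_add (hmulf _ iR) k2, integral_add k1 (j2.const_mul _), integral_add hfi (j1.const_mul t),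
    integral_const_mul, integral_const_mul, e1] at hsh
  rw [hsh]
  have e3 : ∀ A a b c : ℝ, A + (a + t * b + t ^ 2 * c) - (a + b * t + c * t ^ 2) = A := by
    intros; ring
  rw [e3]
  calc |∫ x, f x * R (u ⬝ᵥ x) ∂μ| ≤ ∫ x, |f x * R (u ⬝ᵥ x)| ∂μ := abs_integral_le_integral_abs
    _ ≤ ∫ x, |R (u ⬝ᵥ x)| ∂μ := by
      refine integral_mono (hmulf _ iR).abs iR.abs fun x => ?_
      simp only [abs_mul, abs_of_nonneg (h0 x)]
      nlinarith [h1 x, abs_nonneg (R (u ⬝ᵥ x))]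
    _ = ∫ y, |R (√τ * y)| ∂(gaussianReal 0 1) := h.integral_lin u (fun y => |R y|) (by fun_prop)
    _ ≤ C * |t * √τ| ^ 3 := by
      simp only [hRs]
      exact hT _
    _ = _ := by
      rw [abs_mul, abs_of_nonneg (Real.sqrt_nonneg τ)]; ring


lemma step_lind : ∃ C : ℝ, 0 < C ∧ ∀ (ι : Type) [Fintype ι] (μ : Measure (ι → ℝ))
    (M : Matrix ι ι ℝ), IsG μ M → ∀ (u : ι → ℝ) (α β p : ℝ), 0 ≤ p → p ≤ 1 → |α| ≤ 3 → |β| ≤ 3 →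
    p * α + (1 - p) * β = 0 → p * α ^ 2 + (1 - p) * β ^ 2 = 1 →
    ∀ (f : (ι → ℝ) → ℝ), Measurable f →
    (∀ x, 0 ≤ f x) → (∀ x, f x ≤ 1) →
    |p * ∫ x, f (x + α • (M *ᵥ u)) ∂μ + (1 - p) * ∫ x, f (x + β • (M *ᵥ u)) ∂μ -
      ∫ x, f x ∂(addG μ (M *ᵥ u))| ≤ C * (√(u ⬝ᵥ (M *ᵥ u))) ^ 3 := by
  obtain ⟨C, hC, hT⟩ := step_taylor
  set K := ∫ t, |t| ^ 3 ∂(gaussianReal 0 1) with hK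
  have hK0 : 0 ≤ K := integral_nonneg fun y => by positivity
  refine ⟨C * (27 + K), by positivity, fun ι _ μ M h u α β p hp0 hp1 hα hβ hm hv f hf h0 h1 => ?_⟩
  have := h.prob
  obtain ⟨a, b, c, habc⟩ := hT ι μ M h u f hf h0 h1
  set v := M *ᵥ u
  set σ := √(u ⬝ᵥ v)
  have hσ : 0 ≤ σ := Real.sqrt_nonneg _
  set F : ℝ → ℝ := fun t => ∫ x, f (x + t • v) ∂μ with hF
  have hbd : ∀ {Ω : Type} [MeasurableSpace Ω] (ν : Measure Ω) [IsProbabilityMeasure ν] (g : Ω → ℝ),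
      Measurable g → (∀ x, 0 ≤ g x) → (∀ x, g x ≤ 1) → Integrable g ν := by
    intro Ω _ ν _ g hg g0 g1
    refine Integrable.of_bound hg.aestronglyMeasurable 1 (ae_of_all _ fun x => ?_)
    rw [Real.norm_of_nonneg (g0 x)]; exact g1 x
  have hmm : Measurable (fun p : ℝ × (ι → ℝ) => p.2 + p.1 • v) := by fun_prop
  have iprod : Integrable (fun p : ℝ × (ι → ℝ) => f (p.2 + p.1 • v)) ((gaussianReal 0 1).prod μ) :=
    hbd _ _ (by fun_prop) (fun _ => h0 _) (fun _ => h1 _)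
  have e1 : ∫ x, f x ∂(addG μ v) = ∫ t, F t ∂(gaussianReal 0 1) := by
    rw [addG, integral_map hmm.aemeasurable hf.aestronglyMeasurable, integral_prod _ iprod]
  have iF : Integrable F (gaussianReal 0 1) := iprod.integral_prod_left
  have it : Integrable (fun t : ℝ => t) (gaussianReal 0 1) := by
    have := int_pow 1
    simpa only [pow_one] using this
  have iP : Integrable (fun t : ℝ => a + b * t + c * t ^ 2) (gaussianReal 0 1) :=
    ((integrable_const a).add (it.const_mul b)).add ((int_pow 2).const_mul c)
  have eP : ∫ t, (a + b * t + c * t ^ 2) ∂(gaussianReal 0 1) = a + c := by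
    have k1 : Integrable (fun t : ℝ => a + b * t) (gaussianReal 0 1) :=
      (integrable_const a).add (it.const_mul b)
    rw [integral_add k1 ((int_pow 2).const_mul c),
      integral_add (integrable_const a) (it.const_mul b), integral_const_mul, integral_const_mul,
      int_sq_gauss, integral_id_gaussianReal]
    simp
  have i3 : Integrable (fun t : ℝ => |t| ^ 3) (gaussianReal 0 1) := by
    have := (int_pow 3).abs
    simpa only [abs_pow] using this
  have hG : |∫ t, F t ∂(gaussianReal 0 1) - (a + c)| ≤ C * σ ^ 3 * K := by
    rw [← eP, ← integral_sub iF iP]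
    calc _ ≤ ∫ t, |F t - (a + b * t + c * t ^ 2)| ∂(gaussianReal 0 1) := abs_integral_le_integral_abs
      _ ≤ ∫ t, C * σ ^ 3 * |t| ^ 3 ∂(gaussianReal 0 1) :=
        integral_mono (iF.sub iP).abs (i3.const_mul _) fun t => habc t
      _ = _ := by rw [integral_const_mul]
  have hα3 : |F α - (a + b * α + c * α ^ 2)| ≤ C * σ ^ 3 * 27 := by
    refine (habc α).trans ?_
    have : |α| ^ 3 ≤ 3 ^ 3 := by gcongr
    norm_num at this
    gcongr
  have hβ3 : |F β - (a + b * β + c * β ^ 2)| ≤ C * σ ^ 3 * 27 := by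
    refine (habc β).trans ?_
    have : |β| ^ 3 ≤ 3 ^ 3 := by gcongr
    norm_num at this
    gcongr
  rw [e1]
  change |p * F α + (1 - p) * F β - _| ≤ _
  rw [abs_le] at *
  have q0 : 0 ≤ 1 - p := by linarith
  have key : p * F α + (1 - p) * F β - (a + c) =
      p * (F α - (a + b * α + c * α ^ 2)) + (1 - p) * (F β - (a + b * β + c * β ^ 2)) := by
    linear_combination b * hm + c * hv
  have l1 := mul_le_mul_of_nonneg_left hα3.1 hp0
  have l2 := mul_le_mul_of_nonneg_left hα3.2 hp0
  have l3 := mul_le_mul_of_nonneg_left hβ3.1 q0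
  have l4 := mul_le_mul_of_nonneg_left hβ3.2 q0
  constructor
  · linarith [hG.1, hG.2]
  · linarith [hG.1, hG.2]

lemma det_add_vec {ι : Type} [Fintype ι] [DecidableEq ι] (M : Matrix ι ι ℝ) (u : ι → ℝ) :
    (M + vecMulVec (M *ᵥ u) (M *ᵥ u)).det = M.det * (1 + u ⬝ᵥ (M *ᵥ u)) := by
  have h1 : M + vecMulVec (M *ᵥ u) (M *ᵥ u) = M * (1 + vecMulVec u (M *ᵥ u)) := by
    rw [Matrix.mul_add, mul_one, mul_vecMulVec]
  rw [h1, det_mul, vecMulVec_eq Unit, det_one_add_replicateCol_mul_replicateRow, dotProduct_comm]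

/-- one step, with the elliptical potential bound -/
lemma step_pot : ∃ C : ℝ, 0 < C ∧ ∀ (ι : Type) [Fintype ι] [DecidableEq ι] (μ : Measure (ι → ℝ))
    (M : Matrix ι ι ℝ) (r δ : ℝ), IsG μ M → 0 < r → 0 ≤ δ → δ ≤ 1 → M.IsHermitian →
    (∀ u, r ^ 2 * (u ⬝ᵥ u) ≤ u ⬝ᵥ (M *ᵥ u)) → ∀ v : ι → ℝ, v ⬝ᵥ v ≤ δ ^ 2 * r ^ 2 →
    ∀ (α β p : ℝ), 0 ≤ p → p ≤ 1 → |α| ≤ 3 → |β| ≤ 3 →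
    p * α + (1 - p) * β = 0 → p * α ^ 2 + (1 - p) * β ^ 2 = 1 →
    ∀ (f : (ι → ℝ) → ℝ), Measurable f →
    (∀ x, 0 ≤ f x) → (∀ x, f x ≤ 1) →
    |p * ∫ x, f (x + α • v) ∂μ + (1 - p) * ∫ x, f (x + β • v) ∂μ -
      ∫ x, f x ∂(addG μ v)| ≤ C * δ * (Real.log (M + vecMulVec v v).det - Real.log M.det) := by
  obtain ⟨C, hC, hT⟩ := step_lind
  refine ⟨2 * C, by positivity, fun ι _ _ μ M r δ h hr hδ0 hδ1 hH hlow v hv α β p hp0 hp1 hα hβ hm hvar f hf h0 h1 => ?_⟩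
  have hpd : M.PosDef := by
    refine PosDef.of_dotProduct_mulVec_pos hH fun x hx => ?_
    have h2 : 0 < x ⬝ᵥ x := by
      have := dotProduct_star_self_pos_iff (v := x) |>.2 hx
      simpa using this
    have := hlow x
    simp only [star_trivial]
    have : 0 < r ^ 2 * (x ⬝ᵥ x) := by positivity
    linarith [hlow x]
  have hdet := hpd.det_pos
  have hun : IsUnit M.det := hdet.ne'.isUnit
  obtain ⟨u, rfl⟩ : ∃ u, v = M *ᵥ u := ⟨M⁻¹ *ᵥ v, by
    rw [mulVec_mulVec, Matrix.mul_nonsing_inv _ hun, one_mulVec]⟩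
  have key := hT ι μ M h u α β p hp0 hp1 hα hβ hm hvar f hf h0 h1
  set τ := u ⬝ᵥ (M *ᵥ u) with hτ
  have hτ0 : 0 ≤ τ := h.nonneg u
  have hτδ : τ ≤ δ ^ 2 := by
    have cs : τ ^ 2 ≤ (u ⬝ᵥ u) * ((M *ᵥ u) ⬝ᵥ (M *ᵥ u)) := by
      have := Finset.sum_mul_sq_le_sq_mul_sq Finset.univ u (M *ᵥ u)
      simpa only [dotProduct, sq, hτ] using this
    have hl := hlow u
    have huu : 0 ≤ u ⬝ᵥ u := by simpa using dotProduct_star_self_nonneg u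
    have h3 : τ ^ 2 ≤ δ ^ 2 * τ := by
      calc τ ^ 2 ≤ (u ⬝ᵥ u) * (δ ^ 2 * r ^ 2) := cs.trans (by gcongr)
        _ = δ ^ 2 * (r ^ 2 * (u ⬝ᵥ u)) := by ring
        _ ≤ δ ^ 2 * τ := by gcongr
    rcases hτ0.eq_or_lt with h4 | h4
    · rw [← h4]; positivity
    · nlinarith
  have hsq : √τ ≤ δ := Real.sqrt_le_iff.2 ⟨hδ0, hτδ⟩
  have hτ1 : τ ≤ 1 := by nlinarith
  have h3 : √τ ^ 3 ≤ δ * τ := by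
    have : √τ ^ 3 = √τ * τ := by rw [pow_succ, Real.sq_sqrt hτ0, mul_comm]
    rw [this]; gcongr
  have hlog : τ ≤ 2 * Real.log (1 + τ) := by
    have h5 := Real.one_sub_inv_le_log_of_pos (x := 1 + τ) (by linarith)
    have h6 : τ / 2 ≤ 1 - (1 + τ)⁻¹ := by
      have : 1 - (1 + τ)⁻¹ = τ / (1 + τ) := by field_simp; ring
      rw [this]
      gcongr
      linarith
    linarith
  rw [det_add_vec M u, ← hτ, Real.log_mul hdet.ne' (by linarith)]
  refine key.trans ?_
  calc C * √τ ^ 3 ≤ C * (δ * (2 * Real.log (1 + τ))) := by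
        gcongr
        exact h3.trans (by gcongr)
    _ = _ := by ring

lemma hyp_add {ι : Type} [Fintype ι] (M : Matrix ι ι ℝ) (v : ι → ℝ) (r : ℝ)
    (hH : M.IsHermitian) (hlow : ∀ u, r ^ 2 * (u ⬝ᵥ u) ≤ u ⬝ᵥ (M *ᵥ u)) :
    (M + vecMulVec v v).IsHermitian ∧
      ∀ u, r ^ 2 * (u ⬝ᵥ u) ≤ u ⬝ᵥ ((M + vecMulVec v v) *ᵥ u) := by
  constructor
  · refine hH.add ?_
    ext i j
    simp [vecMulVec_apply, mul_comm]
  · intro u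
    rw [quad_add]
    nlinarith [hlow u, sq_nonneg (u ⬝ᵥ v)]

lemma lind : ∃ C : ℝ, 0 < C ∧ ∀ (ι : Type) [Fintype ι] [DecidableEq ι] (r δ : ℝ), 0 < r →
    0 ≤ δ → δ ≤ 1 → ∀ (n : ℕ) (v : Fin n → ι → ℝ), (∀ j, v j ⬝ᵥ v j ≤ δ ^ 2 * r ^ 2) →
    ∀ (μ : Measure (ι → ℝ)) (M : Matrix ι ι ℝ), IsG μ M → M.IsHermitian →
    (∀ u, r ^ 2 * (u ⬝ᵥ u) ≤ u ⬝ᵥ (M *ᵥ u)) →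
    ∃ μ' : Measure (ι → ℝ), IsG μ' (M + ∑ j, vecMulVec (v j) (v j)) ∧
    ∀ (α β p : ℝ), 0 ≤ p → p ≤ 1 → |α| ≤ 3 → |β| ≤ 3 →
    p * α + (1 - p) * β = 0 → p * α ^ 2 + (1 - p) * β ^ 2 = 1 →
    ∀ (f : (ι → ℝ) → ℝ), Measurable f → (∀ x, 0 ≤ f x) → (∀ x, f x ≤ 1) →
    |∑ b : Fin n → Bool, (∏ j, (if b j then p else 1 - p)) *
        ∫ x, f (x + ∑ j, (if b j then α else β) • v j) ∂μ - ∫ x, f x ∂μ'| ≤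
      C * δ * (Real.log (M + ∑ j, vecMulVec (v j) (v j)).det - Real.log M.det) := by
  obtain ⟨C, hC, hT⟩ := step_pot
  refine ⟨C, hC, fun ι _ _ r δ hr hδ0 hδ1 n => ?_⟩
  induction n with
  | zero =>
    intro v hv μ M h hH hlow
    refine ⟨μ, by simpa using h, ?_⟩
    intros
    simp
  | succ n ih =>
    intro v hv μ M h hH hlow
    obtain ⟨hH', hlow'⟩ := hyp_add M (v 0) r hH hlow
    obtain ⟨μ', hμ', hI⟩ := ih (fun j => v j.succ) (fun j => hv _) (addG μ (v 0))
      (M + vecMulVec (v 0) (v 0)) (h.add (v 0)) hH' hlow'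
    rw [add_assoc, ← Fin.sum_univ_succ (fun j => vecMulVec (v j) (v j))] at hμ'
    refine ⟨μ', hμ', ?_⟩
    intro α β p hp0 hp1 hα hβ hm hvar f hf h0 h1
    have hI' := hI α β p hp0 hp1 hα hβ hm hvar f hf h0 h1
    rw [add_assoc, ← Fin.sum_univ_succ (fun j => vecMulVec (v j) (v j))] at hI'
    set LD := Real.log (M + ∑ j, vecMulVec (v j) (v j)).det
    set W : (Fin n → Bool) → ℝ := fun b => ∏ j, (if b j then p else 1 - p) with hW
    set y : (Fin n → Bool) → (ι → ℝ) := fun b => ∑ j, (if b j then α else β) • v j.succ with hy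
    have hW0 : ∀ b, 0 ≤ W b := fun b => Finset.prod_nonneg fun j _ => by
      split_ifs <;> linarith
    have hW1 : ∑ b, W b = 1 := by
      have := (Finset.prod_univ_sum (fun _ : Fin n => (Finset.univ : Finset Bool))
        (fun _ b => if b then p else 1 - p)).symm
      simp only [Fintype.piFinset_univ] at this
      rw [hW, this]
      simp
    have hsplit : ∑ b : Fin (n + 1) → Bool, (∏ j, (if b j then p else 1 - p)) *
        ∫ x, f (x + ∑ j, (if b j then α else β) • v j) ∂μ =
        ∑ b : Fin n → Bool, W b * (p * ∫ x, f (x + α • v 0 + y b) ∂μ +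
          (1 - p) * ∫ x, f (x + β • v 0 + y b) ∂μ) := by
      rw [← (Fin.consEquiv (fun _ => Bool)).sum_comp, Fintype.sum_prod_type, Fintype.sum_bool,
        ← Finset.sum_add_distrib]
      refine Finset.sum_congr rfl fun b _ => ?_
      simp only [Fin.consEquiv_apply, Fin.prod_univ_succ, Fin.sum_univ_succ, Fin.cons_zero,
        Fin.cons_succ, hW, hy, add_assoc]
      simp
      ring
    have hstep : ∀ b, |(p * ∫ x, f (x + α • v 0 + y b) ∂μ +
          (1 - p) * ∫ x, f (x + β • v 0 + y b) ∂μ) - ∫ x, f (x + y b) ∂(addG μ (v 0))| ≤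
          C * δ * (Real.log (M + vecMulVec (v 0) (v 0)).det - Real.log M.det) := by
      intro b
      exact hT ι μ M r δ h hr hδ0 hδ1 hH hlow (v 0) (hv 0) α β p hp0 hp1 hα hβ hm hvar
        (fun x => f (x + y b)) (by fun_prop) (fun _ => h0 _) (fun _ => h1 _)
    rw [hsplit]
    have h2 : |∑ b : Fin n → Bool, W b * (p * ∫ x, f (x + α • v 0 + y b) ∂μ +
          (1 - p) * ∫ x, f (x + β • v 0 + y b) ∂μ) -
          ∑ b : Fin n → Bool, W b * ∫ x, f (x + y b) ∂(addG μ (v 0))| ≤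
          C * δ * (Real.log (M + vecMulVec (v 0) (v 0)).det - Real.log M.det) := by
      rw [← Finset.sum_sub_distrib]
      calc _ ≤ ∑ b, W b * (C * δ * (Real.log (M + vecMulVec (v 0) (v 0)).det - Real.log M.det)) := by
            refine (Finset.abs_sum_le_sum_abs _ _).trans (Finset.sum_le_sum fun b _ => ?_)
            rw [← mul_sub, abs_mul, abs_of_nonneg (hW0 b)]
            exact mul_le_mul_of_nonneg_left (hstep b) (hW0 b)
        _ = _ := by rw [← Finset.sum_mul, hW1, one_mul]
    calc _ ≤ _ := abs_sub_le _ _ _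
      _ ≤ _ := add_le_add h2 hI'
      _ = _ := by ring



lemma isG_base (ι : Type) [Fintype ι] [DecidableEq ι] (r : ℝ) :
    ∃ μ : Measure (ι → ℝ), IsG μ (r ^ 2 • (1 : Matrix ι ι ℝ)) := by
  have h : ∀ s : Finset ι, ∃ μ : Measure (ι → ℝ),
      IsG μ (∑ i ∈ s, vecMulVec (Pi.single i r : ι → ℝ) (Pi.single i r)) := by
    intro s
    induction s using Finset.induction_on with
    | empty => exact ⟨_, by simpa using isG_zero⟩
    | insert a s ha ih =>
      obtain ⟨μ, hμ⟩ := ih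
      rw [Finset.sum_insert ha, add_comm]
      exact ⟨_, hμ.add _⟩
  obtain ⟨μ, hμ⟩ := h Finset.univ
  refine ⟨μ, ?_⟩
  convert hμ using 1
  ext i j
  simp only [Matrix.smul_apply, Matrix.one_apply, Matrix.sum_apply, vecMulVec_apply, Pi.single_apply]
  by_cases hij : i = j
  · subst hij
    simp [sq]
  · simp [hij]

lemma base_hyp (ι : Type) [Fintype ι] [DecidableEq ι] (r : ℝ) :
    (r ^ 2 • (1 : Matrix ι ι ℝ)).IsHermitian ∧
    ∀ u, r ^ 2 * (u ⬝ᵥ u) ≤ u ⬝ᵥ ((r ^ 2 • (1 : Matrix ι ι ℝ)) *ᵥ u) := by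
  constructor
  · ext i j
    simp [Matrix.one_apply, eq_comm]
  · intro u
    simp [smul_mulVec]

lemma quad_full {ι : Type} [Fintype ι] [DecidableEq ι] (r : ℝ) {n : ℕ} (v : Fin n → ι → ℝ) (u : ι → ℝ) :
    u ⬝ᵥ ((r ^ 2 • (1 : Matrix ι ι ℝ) + ∑ j, vecMulVec (v j) (v j)) *ᵥ u) =
      r ^ 2 * (u ⬝ᵥ u) + ∑ j, (u ⬝ᵥ v j) ^ 2 := by
  rw [add_mulVec, dotProduct_add, sum_mulVec, dotProduct_sum]
  congr 1
  · simp [smul_mulVec]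
  · refine Finset.sum_congr rfl fun j _ => ?_
    rw [vecMulVec_mulVec]
    simp [dotProduct_smul, dotProduct_comm (v j) u, sq]

lemma logdet_le (ι : Type) [Fintype ι] [DecidableEq ι] (r : ℝ) (hr : 0 < r) (n : ℕ)
    (v : Fin n → ι → ℝ) (hv : ∀ j i, v j i * v j i = 1) :
    Real.log (r ^ 2 • (1 : Matrix ι ι ℝ) + ∑ j, vecMulVec (v j) (v j)).det -
      Real.log (r ^ 2 • (1 : Matrix ι ι ℝ)).det ≤ Fintype.card ι * Real.log (1 + n / r ^ 2) := by
  set A := r ^ 2 • (1 : Matrix ι ι ℝ) + ∑ j, vecMulVec (v j) (v j) with hA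
  have hH : A.IsHermitian := by
    refine (base_hyp ι r).1.add ?_
    ext i j
    simp [Matrix.sum_apply, vecMulVec_apply, mul_comm]
  have hpd : A.PosDef := by
    refine PosDef.of_dotProduct_mulVec_pos hH fun x hx => ?_
    have h2 : 0 < x ⬝ᵥ x := by
      have := dotProduct_star_self_pos_iff (v := x) |>.2 hx
      simpa using this
    simp only [star_trivial]
    rw [hA, quad_full]
    have : 0 ≤ ∑ j, (x ⬝ᵥ v j) ^ 2 := Finset.sum_nonneg fun j _ => sq_nonneg _
    positivity
  set m : ℝ := r ^ 2 + n with hm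
  have hm0 : 0 < m := by positivity
  have htr : ∑ i, hH.eigenvalues i = Fintype.card ι * m := by
    have h1 := hH.trace_eq_sum_eigenvalues
    have h2 : A.trace = Fintype.card ι * m := by
      rw [hA, Matrix.trace_add, Matrix.trace_smul, Matrix.trace_one, Matrix.trace_sum]
      have : ∀ j, (vecMulVec (v j) (v j)).trace = Fintype.card ι := by
        intro j
        simp [Matrix.trace, vecMulVec_apply, hv]
      simp [this, hm]
      ring
    rw [h2] at h1
    simpa using h1.symm
  have hdet : Real.log A.det = ∑ i, Real.log (hH.eigenvalues i) := by
    rw [hH.det_eq_prod_eigenvalues]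
    simp only [RCLike.ofReal_real_eq_id, id]
    exact Real.log_prod (fun i _ => (hpd.eigenvalues_pos i).ne')
  have hle : Real.log A.det ≤ Fintype.card ι * Real.log m := by
    rw [hdet]
    calc ∑ i, Real.log (hH.eigenvalues i) ≤ ∑ i, (Real.log m + (hH.eigenvalues i / m - 1)) := by
          refine Finset.sum_le_sum fun i _ => ?_
          have hi := hpd.eigenvalues_pos i
          have := Real.log_le_sub_one_of_pos (div_pos hi hm0)
          rw [Real.log_div hi.ne' hm0.ne'] at this
          linarith
      _ = Fintype.card ι * Real.log m := by
          rw [Finset.sum_add_distrib, Finset.sum_sub_distrib, ← Finset.sum_div, htr]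
          simp
          field_simp
          ring
  have hb : Real.log (r ^ 2 • (1 : Matrix ι ι ℝ)).det = Fintype.card ι * Real.log (r ^ 2) := by
    rw [det_smul, det_one, mul_one, Real.log_pow]
  have : 1 + n / r ^ 2 = m / r ^ 2 := by rw [hm]; field_simp
  rw [hb, this, Real.log_div hm0.ne' (by positivity)]
  linarith

lemma gauss_lower (s r : ℝ) (hr : 0 < r) :
    Real.exp (-(1 / 2)) * Real.exp (-s ^ 2 / (2 * r ^ 2)) ≤
      ∫ y, Real.exp (-(s + r * y) ^ 2 / (2 * r ^ 2)) ∂(gaussianReal 0 1) := by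
  set E := Real.exp (-(1 / 2)) * Real.exp (-s ^ 2 / (2 * r ^ 2)) with hE
  have hE0 : 0 < E := by positivity
  have it : Integrable (fun t : ℝ => t) (gaussianReal 0 1) := by
    have := int_pow 1
    simpa only [pow_one] using this
  have k1 : Integrable (fun y : ℝ => 3 / 2 + (-(s / r)) * y) (gaussianReal 0 1) :=
    (integrable_const _).add (it.const_mul _)
  have k2 : Integrable (fun y : ℝ => 3 / 2 + (-(s / r)) * y + (-(1 / 2)) * y ^ 2) (gaussianReal 0 1) :=
    k1.add ((int_pow 2).const_mul _)
  have e : ∫ y, E * (3 / 2 + (-(s / r)) * y + (-(1 / 2)) * y ^ 2) ∂(gaussianReal 0 1) = E := by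
    rw [integral_const_mul, integral_add k1 ((int_pow 2).const_mul _),
      integral_add (integrable_const _) (it.const_mul _), integral_const_mul, integral_const_mul,
      int_sq_gauss, integral_id_gaussianReal]
    simp
    norm_num
  have iE : Integrable (fun y : ℝ => Real.exp (-(s + r * y) ^ 2 / (2 * r ^ 2))) (gaussianReal 0 1) := by
    refine Integrable.of_bound (by fun_prop) 1 (ae_of_all _ fun y => ?_)
    rw [Real.norm_of_nonneg (Real.exp_pos _).le]
    refine Real.exp_le_one_iff.2 ?_
    rw [neg_div]
    have : 0 ≤ (s + r * y) ^ 2 / (2 * r ^ 2) := by positivity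
    linarith
  rw [← e]
  refine integral_mono (k2.const_mul _) iE fun y => ?_
  have h1 : -(s + r * y) ^ 2 / (2 * r ^ 2) = (-(1 / 2) + -s ^ 2 / (2 * r ^ 2)) +
      (1 / 2 + (-(s / r)) * y + (-(1 / 2)) * y ^ 2) := by
    field_simp
    ring
  simp only
  rw [h1, Real.exp_add, Real.exp_add, ← hE]
  refine mul_le_mul_of_nonneg_left ?_ hE0.le
  refine le_trans (le_of_eq ?_) (Real.add_one_le_exp _)
  ring

lemma gauss_upper (c r σ : ℝ) (hr : 0 < r) (hσ : 0 < σ) :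
      ∫ y, Real.exp (-(c + σ * y) ^ 2 / (2 * r ^ 2)) ∂(gaussianReal 0 1) ≤ r / σ := by
  rw [integral_gaussianReal_eq_integral_smul one_ne_zero]
  set b := σ ^ 2 / (2 * r ^ 2) with hb
  have hb0 : 0 < b := by positivity
  have e1 : ∀ y, Real.exp (-(c + σ * y) ^ 2 / (2 * r ^ 2)) = Real.exp (-b * (y + c / σ) ^ 2) := by
    intro y
    congr 1
    rw [hb]
    field_simp
    ring
  have i1 : Integrable (fun y : ℝ => Real.exp (-b * (y + c / σ) ^ 2)) :=
    (integrable_exp_neg_mul_sq hb0).comp_add_right (c / σ)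
  have e2 : ∫ y : ℝ, Real.exp (-b * (y + c / σ) ^ 2) = √(Real.pi / b) := by
    rw [integral_add_right_eq_self (fun y : ℝ => Real.exp (-b * y ^ 2)), integral_gaussian]
  have hpdf : ∀ y, gaussianPDFReal 0 1 y ≤ (√(2 * Real.pi))⁻¹ := by
    intro y
    simp only [gaussianPDFReal, NNReal.coe_one, mul_one]
    refine mul_le_of_le_one_right (by positivity) (Real.exp_le_one_iff.2 ?_)
    have : 0 ≤ (y - 0) ^ 2 / 2 := by positivity
    rw [neg_div]
    linarith
  simp only [e1, smul_eq_mul]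
  calc _ ≤ ∫ y : ℝ, (√(2 * Real.pi))⁻¹ * Real.exp (-b * (y + c / σ) ^ 2) := by
        refine integral_mono_of_nonneg (ae_of_all _ fun y => ?_) (i1.const_mul _) (ae_of_all _ fun y => ?_)
        · exact mul_nonneg (gaussianPDFReal_nonneg _ _ _) (Real.exp_pos _).le
        · exact mul_le_mul_of_nonneg_right (hpdf y) (Real.exp_pos _).le
    _ = (√(2 * Real.pi))⁻¹ * √(Real.pi / b) := by rw [integral_const_mul, e2]
    _ = r / σ := by
      have : Real.pi / b = (2 * Real.pi) * (r / σ) ^ 2 := by rw [hb]; field_simp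
      rw [this, Real.sqrt_mul (x := 2 * Real.pi) (by positivity), Real.sqrt_sq (by positivity)]
      have : √(2 * Real.pi) ≠ 0 := by positivity
      field_simp

lemma weight_sum (n : ℕ) (p : ℝ) :
    ∑ b : Fin n → Bool, ∏ j, (if b j then p else 1 - p) = 1 := by
  have := (Finset.prod_univ_sum (fun _ : Fin n => (Finset.univ : Finset Bool))
    (fun _ b => if b then p else 1 - p)).symm
  simp only [Fintype.piFinset_univ] at this
  rw [this]
  simp

lemma weight_nonneg {n : ℕ} {p : ℝ} (h0 : 0 ≤ p) (h1 : p ≤ 1) (b : Fin n → Bool) :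
    0 ≤ ∏ j, (if b j then p else 1 - p) := Finset.prod_nonneg fun j _ => by
  split_ifs <;> linarith

lemma anti : ∃ C : ℝ, 0 < C ∧ ∀ (r : ℝ), 1 ≤ r → ∀ (n : ℕ), 1 ≤ n → ∀ (s : Fin n → ℝ),
    (∀ j, s j * s j = 1) → ∀ (c α β p : ℝ), 0 ≤ p → p ≤ 1 → |α| ≤ 3 → |β| ≤ 3 →
    p * α + (1 - p) * β = 0 → p * α ^ 2 + (1 - p) * β ^ 2 = 1 →
    ∑ b : Fin n → Bool, (∏ j, (if b j then p else 1 - p)) *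
      Real.exp (-(c + ∑ j, (if b j then α else β) * s j) ^ 2 / (2 * r ^ 2)) ≤
      C * (r / √n + 1 / r * Real.log (1 + n / r ^ 2)) := by
  obtain ⟨C, hC, hT⟩ := lind
  refine ⟨Real.exp (1 / 2) * (1 + C), by positivity, fun r hr n hn s hs c α β p hp0 hp1 hα hβ hm hv => ?_⟩
  have hr0 : 0 < r := by linarith
  obtain ⟨μ, hμ⟩ := isG_base Unit r
  obtain ⟨b1, b2⟩ := base_hyp Unit r
  set v : Fin n → Unit → ℝ := fun j _ => s j with hvdef
  obtain ⟨μ', hμ', hL⟩ := hT Unit r (1 / r) hr0 (by positivity) (by rw [div_le_one hr0]; exact hr) n v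
    (by
      intro j
      simp [hvdef, dotProduct, hs]
      field_simp
      exact le_rfl) μ _ hμ b1 b2
  set g : (Unit → ℝ) → ℝ := fun x => Real.exp (-(c + (fun _ => 1) ⬝ᵥ x) ^ 2 / (2 * r ^ 2)) with hg
  have hdm := meas_dot (fun _ : Unit => (1 : ℝ))
  have hgm : Measurable g := by fun_prop
  have key := hL α β p hp0 hp1 hα hβ hm hv g hgm (fun x => (Real.exp_pos _).le) (fun x => by
    refine Real.exp_le_one_iff.2 ?_
    rw [neg_div]
    have : 0 ≤ (c + (fun _ => 1) ⬝ᵥ x) ^ 2 / (2 * r ^ 2) := by positivity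
    linarith)
  have hld := logdet_le Unit r hr0 n v (fun j _ => hs j)
  simp only [Fintype.card_unit, Nat.cast_one, one_mul] at hld
  have hq : (fun _ : Unit => (1 : ℝ)) ⬝ᵥ ((r ^ 2 • (1 : Matrix Unit Unit ℝ)) *ᵥ (fun _ => 1)) = r ^ 2 := by
    simp [smul_mulVec, dotProduct]
  have hup : ∫ x, g x ∂μ' ≤ r / √n := by
    rw [hg, hμ'.integral_lin (fun _ => 1) (fun y => Real.exp (-(c + y) ^ 2 / (2 * r ^ 2))) (by fun_prop),
      quad_full]
    have h1 : ∑ j, ((fun _ : Unit => (1 : ℝ)) ⬝ᵥ v j) ^ 2 = n := by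
      simp [hvdef, dotProduct, sq, hs]
    rw [h1]
    have hn0 : (0 : ℝ) < n := by exact_mod_cast hn
    have h2 : √(n : ℝ) ≤ √(r ^ 2 * ((fun _ : Unit => (1 : ℝ)) ⬝ᵥ (fun _ => 1)) + n) := by
      refine Real.sqrt_le_sqrt ?_
      simp [dotProduct]
      positivity
    have h3 : 0 < √(n : ℝ) := by positivity
    refine (gauss_upper c r _ hr0 (h3.trans_le h2)).trans ?_
    gcongr
  have hlow : ∀ b : Fin n → Bool,
      Real.exp (-(c + ∑ j, (if b j then α else β) * s j) ^ 2 / (2 * r ^ 2)) ≤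
      Real.exp (1 / 2) * ∫ x, g (x + ∑ j, (if b j then α else β) • v j) ∂μ := by
    intro b
    set y := ∑ j, (if b j then α else β) * s j with hy
    have h1 : ∀ x, g (x + ∑ j, (if b j then α else β) • v j) =
        Real.exp (-((c + y) + (fun _ => 1) ⬝ᵥ x) ^ 2 / (2 * r ^ 2)) := by
      intro x
      simp only [hg]
      congr 4
      simp only [dotProduct, hy, hvdef, Finset.univ_unique, Finset.sum_singleton, Pi.add_apply,
        Finset.sum_apply, Pi.smul_apply, smul_eq_mul, one_mul]
      ring
    simp only [h1]
    rw [hμ.integral_lin (fun _ => 1) (fun z => Real.exp (-((c + y) + z) ^ 2 / (2 * r ^ 2))) (by fun_prop),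
      hq, Real.sqrt_sq hr0.le]
    have := gauss_lower (c + y) r hr0
    calc _ = Real.exp (1 / 2) * (Real.exp (-(1 / 2)) * Real.exp (-(c + y) ^ 2 / (2 * r ^ 2))) := by
          rw [← mul_assoc, ← Real.exp_add]; norm_num
      _ ≤ _ := by gcongr
  have hlog : 0 ≤ Real.log (1 + n / r ^ 2) := Real.log_nonneg (by
    have : 0 ≤ (n : ℝ) / r ^ 2 := by positivity
    linarith)
  calc _ ≤ ∑ b : Fin n → Bool, (∏ j, (if b j then p else 1 - p)) *
      (Real.exp (1 / 2) * ∫ x, g (x + ∑ j, (if b j then α else β) • v j) ∂μ) :=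
        Finset.sum_le_sum fun b _ => mul_le_mul_of_nonneg_left (hlow b) (weight_nonneg hp0 hp1 b)
    _ = Real.exp (1 / 2) * ∑ b : Fin n → Bool, (∏ j, (if b j then p else 1 - p)) *
      (∫ x, g (x + ∑ j, (if b j then α else β) • v j) ∂μ) := by
        rw [Finset.mul_sum]
        exact Finset.sum_congr rfl fun b _ => by ring
    _ ≤ Real.exp (1 / 2) * (r / √n + C * (1 / r) * Real.log (1 + n / r ^ 2)) := by
        gcongr
        have h5 : C * (1 / r) * (Real.log (r ^ 2 • (1 : Matrix Unit Unit ℝ) + ∑ j, vecMulVec (v j) (v j)).det -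
            Real.log (r ^ 2 • (1 : Matrix Unit Unit ℝ)).det) ≤ C * (1 / r) * Real.log (1 + n / r ^ 2) := by
          gcongr
        have := (abs_le.1 key).2
        linarith
    _ ≤ _ := by
        refine (mul_le_mul_of_nonneg_left ?_ (Real.exp_pos _).le).trans (le_of_eq (mul_assoc _ _ _).symm)
        have h6 : 0 ≤ r / √n := by positivity
        have h7 : 0 ≤ 1 / r * Real.log (1 + n / r ^ 2) := by positivity
        have h8 : 0 ≤ C * (r / √n) := by positivity
        linarith


/-- sign pattern of a vector, shifted by `c` -/
noncomputable def sgnv {q : ℕ} (c x : Fin q → ℝ) : Fin q → Bool :=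
  fun i => if 0 ≤ c i + x i then true else false

noncomputable def testf {q : ℕ} (T : (Fin q → Bool) → Bool) (c x : Fin q → ℝ) : ℝ :=
  if T (sgnv c x) then 1 else 0

lemma testf_meas {q : ℕ} (T : (Fin q → Bool) → Bool) (c : Fin q → ℝ) : Measurable (testf T c) := by
  have h1 : Measurable (sgnv c) := by
    refine measurable_pi_lambda _ fun i => ?_
    refine Measurable.ite ?_ measurable_const measurable_const
    exact measurableSet_le measurable_const (by fun_prop)
  have h2 : Measurable (fun y : Fin q → Bool => if T y then (1 : ℝ) else 0) := measurable_of_finite _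
  exact h2.comp h1

lemma testf_nonneg {q : ℕ} (T : (Fin q → Bool) → Bool) (c x : Fin q → ℝ) : 0 ≤ testf T c x := by
  unfold testf; split_ifs <;> norm_num

lemma testf_le {q : ℕ} (T : (Fin q → Bool) → Bool) (c x : Fin q → ℝ) : testf T c x ≤ 1 := by
  unfold testf; split_ifs <;> norm_num

lemma testf_diff {q : ℕ} (T : (Fin q → Bool) → Bool) (c y z : Fin q → ℝ) (t : Fin q → ℝ)
    (ht : ∀ i, 0 ≤ t i) :
    |testf T c y - testf T c (z + y)| ≤ ∑ i, (Real.exp (t i * z i - t i * |c i + y i|) +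
      Real.exp (-t i * z i - t i * |c i + y i|)) := by
  by_cases h : ∀ i, |z i| < |c i + y i|
  · have : sgnv c y = sgnv c (z + y) := by
      ext i
      have hi := h i
      unfold sgnv
      have : (0 ≤ c i + y i) ↔ 0 ≤ c i + (z + y) i := by
        rw [Pi.add_apply]
        have h1 := abs_lt.1 hi
        rcases abs_cases (c i + y i) with ⟨h2, h3⟩ | ⟨h2, h3⟩
        · constructor
          · intro; linarith [h1.1]
          · intro; exact h3
        · constructor
          · intro; linarith
          · intro; linarith [h1.2]
      simp only [this]
    have h2 : testf T c y = testf T c (z + y) := by unfold testf; rw [this]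
    rw [h2, sub_self, abs_zero]
    exact Finset.sum_nonneg fun i _ => by positivity
  · push Not at h
    obtain ⟨i, hi⟩ := h
    have h1 : |testf T c y - testf T c (z + y)| ≤ 1 := by
      rw [abs_le]
      constructor <;> linarith [testf_nonneg T c y, testf_nonneg T c (z + y), testf_le T c y, testf_le T c (z + y)]
    refine h1.trans ?_
    refine le_trans ?_ (Finset.single_le_sum (f := fun i => Real.exp (t i * z i - t i * |c i + y i|) +
      Real.exp (-t i * z i - t i * |c i + y i|)) (fun i _ => by positivity) (Finset.mem_univ i))
    have hti := mul_le_mul_of_nonneg_left hi (ht i)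
    rcases abs_cases (z i) with ⟨h2, h3⟩ | ⟨h2, h3⟩
    · rw [h2] at hti
      have := Real.one_le_exp (x := t i * z i - t i * |c i + y i|) (by linarith)
      have := Real.exp_pos (-t i * z i - t i * |c i + y i|)
      linarith
    · rw [h2] at hti
      have := Real.one_le_exp (x := -t i * z i - t i * |c i + y i|) (by linarith)
      have := Real.exp_pos (t i * z i - t i * |c i + y i|)
      linarith

lemma base_exp {q : ℕ} (r : ℝ) (hr : 0 < r) (μ : Measure (Fin q → ℝ))
    (hμ : IsG μ (r ^ 2 • (1 : Matrix (Fin q) (Fin q) ℝ))) (i : Fin q) (t a : ℝ) :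
    Integrable (fun z : Fin q → ℝ => Real.exp (t * z i - a)) μ ∧
    ∫ z, Real.exp (t * z i - a) ∂μ = Real.exp (t ^ 2 * r ^ 2 / 2 - a) := by
  have hq : (Pi.single i 1 : Fin q → ℝ) ⬝ᵥ ((r ^ 2 • (1 : Matrix (Fin q) (Fin q) ℝ)) *ᵥ (Pi.single i 1)) = r ^ 2 := by
    simp [smul_mulVec]
  have he : ∀ z : Fin q → ℝ, Real.exp (t * z i - a) =
      (fun y => Real.exp (t * y - a)) ((Pi.single i 1 : Fin q → ℝ) ⬝ᵥ z) := by
    intro z; simp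
  have h2 : (fun y => Real.exp (t * (r * y) - a)) = fun y => Real.exp ((t * r) * y) * Real.exp (-a) := by
    ext y; rw [← Real.exp_add]; ring_nf
  simp only [he]
  constructor
  · refine hμ.integrable_lin _ (fun y => Real.exp (t * y - a)) (by fun_prop) ?_
    rw [hq, Real.sqrt_sq hr.le, h2]
    exact (integrable_exp_mul_gaussianReal (t * r)).mul_const _
  · rw [hμ.integral_lin _ (fun y => Real.exp (t * y - a)) (by fun_prop), hq, Real.sqrt_sq hr.le, h2,
      integral_mul_const]
    have h := congrFun (mgf_fun_id_gaussianReal (μ := 0) (v := 1)) (t * r)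
    simp only [mgf] at h
    rw [h, ← Real.exp_add]
    congr 1
    simp
    ring

lemma smooth_err {q : ℕ} (r : ℝ) (hr : 0 < r) (μ : Measure (Fin q → ℝ))
    (hμ : IsG μ (r ^ 2 • (1 : Matrix (Fin q) (Fin q) ℝ))) (T : (Fin q → Bool) → Bool)
    (c y : Fin q → ℝ) :
    |testf T c y - ∫ z, testf T c (z + y) ∂μ| ≤
      ∑ i, 2 * Real.exp (-(c i + y i) ^ 2 / (2 * r ^ 2)) := by
  have := hμ.prob
  set t : Fin q → ℝ := fun i => |c i + y i| / r ^ 2 with ht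
  have hm := testf_meas T c
  have i1 : Integrable (fun z => testf T c (z + y)) μ := by
    refine Integrable.of_bound (Measurable.aestronglyMeasurable (by fun_prop)) 1 (ae_of_all _ fun x => ?_)
    rw [Real.norm_of_nonneg (testf_nonneg _ _ _)]; exact testf_le _ _ _
  have i2 : ∀ i ∈ (Finset.univ : Finset (Fin q)), Integrable (fun z : Fin q → ℝ => Real.exp (t i * z i - t i * |c i + y i|) +
      Real.exp (-t i * z i - t i * |c i + y i|)) μ := fun i _ =>
    (base_exp r hr μ hμ i (t i) _).1.add (base_exp r hr μ hμ i (-t i) _).1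
  have e1 : testf T c y - ∫ z, testf T c (z + y) ∂μ = ∫ z, (testf T c y - testf T c (z + y)) ∂μ := by
    rw [integral_sub (integrable_const _) i1]
    simp
  rw [e1]
  calc _ ≤ ∫ z, |testf T c y - testf T c (z + y)| ∂μ := abs_integral_le_integral_abs
    _ ≤ ∫ z, ∑ i, (Real.exp (t i * z i - t i * |c i + y i|) +
      Real.exp (-t i * z i - t i * |c i + y i|)) ∂μ := by
        refine integral_mono ((integrable_const _).sub i1).abs (integrable_finsetSum _ i2) fun z => ?_
        exact testf_diff T c y z t (fun i => by positivity)
    _ = _ := by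
        rw [integral_finsetSum _ i2]
        refine Finset.sum_congr rfl fun i _ => ?_
        rw [integral_add (base_exp r hr μ hμ i (t i) _).1 (base_exp r hr μ hμ i (-t i) _).1,
          (base_exp r hr μ hμ i (t i) _).2, (base_exp r hr μ hμ i (-t i) _).2, neg_sq, ← two_mul]
        congr 2
        simp only [ht, div_pow, sq_abs]
        rw [div_mul_eq_mul_div |c i + y i|, abs_mul_abs_self]
        field_simp
        ring

lemma leg : ∃ C : ℝ, 0 < C ∧ ∀ (q n : ℕ), 1 ≤ q → 1 ≤ n → ∀ r : ℝ, (q : ℝ) ≤ r ^ 2 → 0 < r →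
    ∀ (v : Fin n → Fin q → ℝ), (∀ j i, v j i * v j i = 1) → ∀ c : Fin q → ℝ,
    ∀ T : (Fin q → Bool) → Bool, ∃ I : ℝ, 
    ∀ (α β p : ℝ), 0 ≤ p → p ≤ 1 → |α| ≤ 3 → |β| ≤ 3 →
    p * α + (1 - p) * β = 0 → p * α ^ 2 + (1 - p) * β ^ 2 = 1 →
    |∑ b : Fin n → Bool, (∏ j, (if b j then p else 1 - p)) *
        testf T c (∑ j, (if b j then α else β) • v j) - I| ≤
      C * (q * (r / √n) + q * √q / r * Real.log (1 + n / r ^ 2)) := by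
  obtain ⟨C1, hC1, hL⟩ := lind
  obtain ⟨C2, hC2, hA⟩ := anti
  refine ⟨C1 + 2 * C2, by positivity, fun q n hq hn r hqr hr v hv c T => ?_⟩
  obtain ⟨μ, hμ⟩ := isG_base (Fin q) r
  obtain ⟨b1, b2⟩ := base_hyp (Fin q) r
  have hq1 : (1 : ℝ) ≤ q := by exact_mod_cast hq
  have hr1 : 1 ≤ r := by nlinarith
  have hsq : 1 ≤ √(q : ℝ) := Real.one_le_sqrt.2 hq1
  obtain ⟨μ', hμ', hL'⟩ := hL (Fin q) r (√q / r) hr (by positivity)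
    (by rw [div_le_one hr]; exact Real.sqrt_le_iff.2 ⟨hr.le, hqr⟩) n v
    (by
      intro j
      simp only [dotProduct, hv, div_pow, Real.sq_sqrt (by positivity : (0 : ℝ) ≤ q)]
      field_simp
      simp) μ _ hμ b1 b2
  refine ⟨∫ x, testf T c x ∂μ', fun α β p hp0 hp1 hα hβ hm hvar => ?_⟩
  have key := hL' α β p hp0 hp1 hα hβ hm hvar (testf T c) (testf_meas T c) (testf_nonneg T c) (testf_le T c)
  have hld := logdet_le (Fin q) r hr n v hv
  rw [Fintype.card_fin] at hld
  set L := Real.log (1 + n / r ^ 2) with hLdef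
  have hL0 : 0 ≤ L := Real.log_nonneg (by
    have : 0 ≤ (n : ℝ) / r ^ 2 := by positivity
    linarith)
  set W : (Fin n → Bool) → ℝ := fun b => ∏ j, (if b j then p else 1 - p) with hW
  set y : (Fin n → Bool) → (Fin q → ℝ) := fun b => ∑ j, (if b j then α else β) • v j with hy
  have hW0 : ∀ b, 0 ≤ W b := fun b => weight_nonneg hp0 hp1 b
  have key' : |∑ b, W b * ∫ x, testf T c (x + y b) ∂μ - ∫ x, testf T c x ∂μ'| ≤ C1 * (q * √q / r * L) := by
    refine key.trans ?_
    calc _ ≤ C1 * (√q / r) * (q * L) := by gcongr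
      _ = _ := by ring
  have hsm : |∑ b, W b * testf T c (y b) - ∑ b, W b * ∫ x, testf T c (x + y b) ∂μ| ≤
      2 * C2 * (q * (r / √n + 1 / r * L)) := by
    rw [← Finset.sum_sub_distrib]
    calc _ ≤ ∑ b, W b * ∑ i, 2 * Real.exp (-(c i + y b i) ^ 2 / (2 * r ^ 2)) := by
          refine (Finset.abs_sum_le_sum_abs _ _).trans (Finset.sum_le_sum fun b _ => ?_)
          rw [← mul_sub, abs_mul, abs_of_nonneg (hW0 b)]
          exact mul_le_mul_of_nonneg_left (smooth_err r hr μ hμ T c (y b)) (hW0 b)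
      _ = ∑ i, 2 * ∑ b, W b * Real.exp (-(c i + y b i) ^ 2 / (2 * r ^ 2)) := by
          simp only [Finset.mul_sum]
          rw [Finset.sum_comm]
          refine Finset.sum_congr rfl fun i _ => Finset.sum_congr rfl fun b _ => by ring
      _ ≤ ∑ i : Fin q, 2 * (C2 * (r / √n + 1 / r * L)) := by
          refine Finset.sum_le_sum fun i _ => ?_
          have := hA r hr1 n hn (fun j => v j i) (fun j => hv j i) (c i) α β p hp0 hp1 hα hβ hm hvar
          refine mul_le_mul_of_nonneg_left (le_trans (le_of_eq ?_) this) (by norm_num)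
          refine Finset.sum_congr rfl fun b _ => ?_
          simp only [hy, hW, Finset.sum_apply, Pi.smul_apply, smul_eq_mul]
      _ = _ := by
          simp
          ring
  have hfin : q * (r / √n + 1 / r * L) ≤ q * (r / √n) + q * √q / r * L := by
    have : 1 / r * L * q ≤ √q / r * L * q := by gcongr
    calc _ = q * (r / √n) + 1 / r * L * q := by ring
      _ ≤ q * (r / √n) + √q / r * L * q := by linarith
      _ = _ := by ring
  have hfin2 : q * √q / r * L ≤ q * (r / √n) + q * √q / r * L := by
    have : 0 ≤ q * (r / √n) := by positivity
    linarith
  calc _ ≤ _ := abs_sub_le _ (∑ b, W b * ∫ x, testf T c (x + y b) ∂μ) _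
    _ ≤ 2 * C2 * (q * (r / √n + 1 / r * L)) + C1 * (q * √q / r * L) := add_le_add hsm key'
    _ ≤ 2 * C2 * (q * (r / √n) + q * √q / r * L) + C1 * (q * (r / √n) + q * √q / r * L) := by
      gcongr
    _ = _ := by ring

lemma numeric (q n : ℕ) (hq : 1 ≤ q) (hn : 2 ≤ n) (hqn : q ≤ n) :
    ∃ r : ℝ, (q : ℝ) ≤ r ^ 2 ∧ 0 < r ∧
      q * (r / √n) + q * √q / r * Real.log (1 + n / r ^ 2) ≤
      4 * ((q : ℝ) ^ ((5 : ℝ)/4) * (Real.log n) ^ ((1 : ℝ)/2) / (n : ℝ) ^ ((1 : ℝ)/4)) := by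
  have hq1 : (1 : ℝ) ≤ q := by exact_mod_cast hq
  have hn2 : (2 : ℝ) ≤ n := by exact_mod_cast hn
  have hqn' : (q : ℝ) ≤ n := by exact_mod_cast hqn
  have hq0 : (0 : ℝ) < q := by linarith
  have hn0 : (0 : ℝ) < n := by linarith
  set a := (q : ℝ) ^ ((1 : ℝ)/4) with ha
  set d := (n : ℝ) ^ ((1 : ℝ)/4) with hd
  set l := (Real.log n) ^ ((1 : ℝ)/2) with hl
  have hlogn : 1 / 2 < Real.log n := by
    have := Real.log_two_gt_d9
    have h2 : Real.log 2 ≤ Real.log n := Real.log_le_log (by norm_num) hn2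
    linarith
  have ha0 : 0 < a := by positivity
  have hd0 : 0 < d := by positivity
  have hl0 : 0 < l := Real.rpow_pos_of_pos (by linarith) _
  have ha4 : a ^ 4 = q := by
    rw [ha, ← Real.rpow_natCast, ← Real.rpow_mul hq0.le]; norm_num
  have hd4 : d ^ 4 = n := by
    rw [hd, ← Real.rpow_natCast, ← Real.rpow_mul hn0.le]; norm_num
  have hl2 : l ^ 2 = Real.log n := by
    rw [hl, ← Real.rpow_natCast, ← Real.rpow_mul (by linarith)]; norm_num
  have hq5 : (q : ℝ) ^ ((5 : ℝ)/4) = a ^ 5 := by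
    rw [ha, ← Real.rpow_natCast, ← Real.rpow_mul hq0.le]; norm_num
  have hsq : √(q : ℝ) = a ^ 2 := by
    rw [← ha4, show a ^ 4 = (a ^ 2) ^ 2 by ring, Real.sqrt_sq (by positivity)]
  have hsn : √(n : ℝ) = d ^ 2 := by
    rw [← hd4, show d ^ 4 = (d ^ 2) ^ 2 by ring, Real.sqrt_sq (by positivity)]
  have had : a ≤ d := by rw [ha, hd]; gcongr
  have hr2 : (q : ℝ) ≤ (2 * a * d * l) ^ 2 := by
    rw [← ha4, show (2 * a * d * l) ^ 2 = 4 * a ^ 2 * d ^ 2 * l ^ 2 by ring, hl2]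
    have : a ^ 2 ≤ d ^ 2 := by gcongr
    have h3 : a ^ 2 * a ^ 2 ≤ a ^ 2 * d ^ 2 := by gcongr
    have h4 : 0 ≤ a ^ 2 * d ^ 2 := by positivity
    nlinarith
  refine ⟨2 * a * d * l, hr2, by positivity, ?_⟩
  have hlog : Real.log (1 + n / (2 * a * d * l) ^ 2) ≤ 2 * l ^ 2 := by
    rw [hl2, show 2 * Real.log n = Real.log ((n : ℝ) ^ 2) by rw [Real.log_pow]; norm_num]
    refine Real.log_le_log (by positivity) ?_
    have : (n : ℝ) / (2 * a * d * l) ^ 2 ≤ n := div_le_self hn0.le (by linarith)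
    nlinarith
  rw [hq5, hsq, hsn]
  have e1 : (q : ℝ) * (2 * a * d * l / d ^ 2) = 2 * (a ^ 5 * l / d) := by
    rw [← ha4]; field_simp
  have e2 : (q : ℝ) * a ^ 2 / (2 * a * d * l) * (2 * l ^ 2) = a ^ 5 * l / d := by
    rw [← ha4]; field_simp
  have h5 : (q : ℝ) * a ^ 2 / (2 * a * d * l) * Real.log (1 + n / (2 * a * d * l) ^ 2) ≤
      (q : ℝ) * a ^ 2 / (2 * a * d * l) * (2 * l ^ 2) := by gcongr
  have h6 : 0 ≤ a ^ 5 * l / d := by positivity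
  linarith

lemma trivial_case (q n : ℕ) (hn : 2 ≤ n) (hqn : n < q) :
    1 ≤ 4 * ((q : ℝ) ^ ((5 : ℝ)/4) * (Real.log n) ^ ((1 : ℝ)/2) / (n : ℝ) ^ ((1 : ℝ)/4)) := by
  have hn2 : (2 : ℝ) ≤ n := by exact_mod_cast hn
  have hqn' : (n : ℝ) ≤ q := by exact_mod_cast hqn.le
  have hn0 : (0 : ℝ) < n := by linarith
  have hq0 : (0 : ℝ) < q := by linarith
  have hlogn : 1 / 2 < Real.log n := by
    have := Real.log_two_gt_d9
    have h2 : Real.log 2 ≤ Real.log n := Real.log_le_log (by norm_num) hn2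
    linarith
  have h1 : (n : ℝ) ^ ((1 : ℝ)/4) ≤ (q : ℝ) ^ ((5 : ℝ)/4) := by
    calc (n : ℝ) ^ ((1 : ℝ)/4) ≤ (q : ℝ) ^ ((1 : ℝ)/4) := by gcongr
      _ ≤ _ := Real.rpow_le_rpow_of_exponent_le (by linarith) (by norm_num)
  have h2 : 1 / 4 ≤ (Real.log n) ^ ((1 : ℝ)/2) := by
    rw [← Real.sqrt_eq_rpow]
    exact Real.le_sqrt_of_sq_le (by norm_num; linarith)
  have h3 : 0 < (n : ℝ) ^ ((1 : ℝ)/4) := by positivity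
  rw [← mul_div_assoc, le_div_iff₀ h3]
  have h4 : 0 < (q : ℝ) ^ ((5 : ℝ)/4) := by positivity
  nlinarith

lemma pm_mul (b : Bool) : pm b * pm b = 1 := by cases b <;> simp [pm]

lemma yes_eq {q n : ℕ} (Q : Fin q → (Fin n → Bool)) (T : (Fin q → Bool) → Bool) :
    (∑ s : Fin n → Bool, ((1 : ℝ)/2) ^ n * (if T (fun i => fYes s (Q i)) then 1 else 0)) =
    ∑ b : Fin n → Bool, (∏ j, (if b j then (1 / 2 : ℝ) else 1 - 1 / 2)) *
        testf T (fun i => ∑ j, 2 * pm (Q i j)) (∑ j, (if b j then (1 : ℝ) else -1) • fun i => pm (Q i j)) := by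
  refine Finset.sum_congr rfl fun b _ => ?_
  congr 1
  · have h : (1 - 1 / 2 : ℝ) = 1 / 2 := by norm_num
    rw [h]
    simp
  · unfold testf
    have : (fun i => fYes b (Q i)) = sgnv (fun i => ∑ j, 2 * pm (Q i j))
        (∑ j, (if b j then (1 : ℝ) else -1) • fun i => pm (Q i j)) := by
      funext i
      unfold fYes sgnv
      have : ∑ j : Fin n, (if b j then (3 : ℝ) else 1) * pm (Q i j) = ∑ j, 2 * pm (Q i j) +
        (∑ j, (if b j then (1 : ℝ) else -1) • fun i => pm (Q i j)) i := by
        simp only [Finset.sum_apply, Pi.smul_apply, smul_eq_mul, ← Finset.sum_add_distrib]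
        refine Finset.sum_congr rfl fun j _ => ?_
        split_ifs <;> ring
      rw [this]
    rw [this]

lemma no_eq {q n : ℕ} (Q : Fin q → (Fin n → Bool)) (T : (Fin q → Bool) → Bool) :
    (∑ b : Fin n → Bool, wNo b * (if T (fun i => fNo b (Q i)) then 1 else 0)) =
    ∑ b : Fin n → Bool, (∏ j, (if b j then (9 / 10 : ℝ) else 1 - 9 / 10)) *
        testf T (fun i => ∑ j, 2 * pm (Q i j)) (∑ j, (if b j then (1 / 3 : ℝ) else -3) • fun i => pm (Q i j)) := by
  refine Finset.sum_congr rfl fun b _ => ?_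
  congr 1
  · unfold wNo
    norm_num
  · unfold testf
    have : (fun i => fNo b (Q i)) = sgnv (fun i => ∑ j, 2 * pm (Q i j))
        (∑ j, (if b j then (1 / 3 : ℝ) else -3) • fun i => pm (Q i j)) := by
      funext i
      unfold fNo sgnv
      have : ∑ j : Fin n, (if b j then (7 : ℝ) / 3 else -1) * pm (Q i j) = ∑ j, 2 * pm (Q i j) +
        (∑ j, (if b j then (1 / 3 : ℝ) else -3) • fun i => pm (Q i j)) i := by
        simp only [Finset.sum_apply, Pi.smul_apply, smul_eq_mul, ← Finset.sum_add_distrib]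
        refine Finset.sum_congr rfl fun j _ => ?_
        split_ifs <;> ring
      rw [this]
    rw [this]

lemma exp_unit {q n : ℕ} (p : ℝ) (h0 : 0 ≤ p) (h1 : p ≤ 1) (T : (Fin q → Bool) → Bool) (c : Fin q → ℝ)
    (y : (Fin n → Bool) → Fin q → ℝ) :
    0 ≤ ∑ b : Fin n → Bool, (∏ j, (if b j then p else 1 - p)) * testf T c (y b) ∧
    ∑ b : Fin n → Bool, (∏ j, (if b j then p else 1 - p)) * testf T c (y b) ≤ 1 := by
  constructor
  · exact Finset.sum_nonneg fun b _ => mul_nonneg (weight_nonneg h0 h1 b) (testf_nonneg _ _ _)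
  · exact le_trans (Finset.sum_le_sum fun b _ =>
      mul_le_of_le_one_right (weight_nonneg h0 h1 b) (testf_le _ _ _)) (weight_sum n p).le

theorem cant_distinguish_yes_no :
    ∃ C : ℝ, 0 < C ∧ ∀ q n : ℕ, 1 ≤ q → 2 ≤ n →
      ∀ (Q : Fin q → (Fin n → Bool)) (T : (Fin q → Bool) → Bool),
        |(∑ s : Fin n → Bool, ((1 : ℝ)/2) ^ n *
            (if T (fun i => fYes s (Q i)) then 1 else 0)) -
         (∑ b : Fin n → Bool, wNo b *
            (if T (fun i => fNo b (Q i)) then 1 else 0))| ≤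
          C * (q : ℝ) ^ ((5 : ℝ)/4) * (Real.log n) ^ ((1 : ℝ)/2) / (n : ℝ) ^ ((1 : ℝ)/4) := by
  obtain ⟨C, hC, hleg⟩ := leg
  refine ⟨4 * (2 * C + 1), by positivity, fun q n hq hn Q T => ?_⟩
  rw [yes_eq, no_eq]
  have hR : 4 * (2 * C + 1) * (q : ℝ) ^ ((5 : ℝ)/4) * (Real.log n) ^ ((1 : ℝ)/2) / (n : ℝ) ^ ((1 : ℝ)/4) =
    (2 * C + 1) * (4 * ((q : ℝ) ^ ((5 : ℝ)/4) * (Real.log n) ^ ((1 : ℝ)/2) / (n : ℝ) ^ ((1 : ℝ)/4))) := by ring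
  rw [hR]
  rcases le_or_gt q n with hqn | hqn
  · obtain ⟨r, hr1, hr0, hr⟩ := numeric q n hq hn hqn
    obtain ⟨I, hI⟩ := hleg q n hq (by omega) r hr1 hr0 (fun j i => pm (Q i j)) (fun j i => pm_mul _)
      (fun i => ∑ j, 2 * pm (Q i j)) T
    have hy := hI 1 (-1) (1 / 2) (by norm_num) (by norm_num) (by norm_num) (by norm_num) (by norm_num) (by norm_num)
    have hno := hI (1 / 3) (-3) (9 / 10) (by norm_num) (by norm_num) (by norm_num [abs_of_pos]) (by norm_num)
      (by norm_num) (by norm_num)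
    set B := 4 * ((q : ℝ) ^ ((5 : ℝ)/4) * (Real.log n) ^ ((1 : ℝ)/2) / (n : ℝ) ^ ((1 : ℝ)/4))
    have hB : 0 ≤ B := by
      have : 0 ≤ Real.log n := Real.log_natCast_nonneg n
      positivity
    have hCr := mul_le_mul_of_nonneg_left hr hC.le
    rw [abs_sub_comm] at hno
    refine (abs_sub_le _ I _).trans ((add_le_add hy hno).trans ?_)
    linarith
  · have ht := trivial_case q n hn hqn
    have u1 := exp_unit (n := n) (1 / 2) (by norm_num) (by norm_num) T (fun i => ∑ j, 2 * pm (Q i j))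
      (fun b => (∑ j, (if b j then (1 : ℝ) else -1) • fun i => pm (Q i j)))
    have u2 := exp_unit (n := n) (9 / 10) (by norm_num) (by norm_num) T (fun i => ∑ j, 2 * pm (Q i j))
      (fun b => (∑ j, (if b j then (1 / 3 : ℝ) else -3) • fun i => pm (Q i j)))
    have : (1 : ℝ) ≤ (2 * C + 1) * (4 * ((q : ℝ) ^ ((5 : ℝ)/4) * (Real.log n) ^ ((1 : ℝ)/2) / (n : ℝ) ^ ((1 : ℝ)/4))) := by
      nlinarith
    refine le_trans ?_ this
    rw [abs_le]
    constructor <;> linarith [u1.1, u1.2, u2.1, u2.2]
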